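/- Consider the (1+1) EA on the chance-constrained knapsack problem with correlated uniform weights, with n ≥ 2. There is a constant C > 0 depending only on c and d (but not on n, K, m, a, B, α, or the profits) such that, for any group structure K, m ≥ 1 (n = K·m), any profits p_{ij} ≥ 0, any parameters a > 0, B > 0, 0 < α < 1, and every initial solution x₀ ∈ {0,1}^n, the expected number of iterations until the current solution is feasible for the first time is at most C·n²·(1 + log n). -/

import Mathlib

open Finset
open scoped ENNReal

noncomputable section

/-- Number of one-bits (selected items) of a solution. -/
def numOnes (K m : ℕ) (x : Fin K → Fin m → Bool) : ℕ :=
  ∑ i, ∑ j, if x i j then 1 else 0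

/-- Covariance contribution `2c·Σᵢ Σ_{j1<j2} x_{ij1}·x_{ij2}` of a solution. -/
def cova (K m : ℕ) (c : ℝ) (x : Fin K → Fin m → Bool) : ℝ :=
  2 * c * ∑ i, ∑ p ∈ Finset.univ.filter (fun p : Fin m × Fin m => p.1 < p.2),
      (if x i p.1 then (1 : ℝ) else 0) * (if x i p.2 then (1 : ℝ) else 0)

/-- Expected weight `E[W(x)] = a·|x|₁`. -/
def expWeight (K m : ℕ) (a : ℝ) (x : Fin K → Fin m → Bool) : ℝ :=
  a * (numOnes K m x : ℝ)

/-- Variance `Var[W(x)] = d·|x|₁ + 2c·Σᵢ Σ_{j1<j2} x_{ij1}·x_{ij2}`. -/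
def varWeight (K m : ℕ) (d c : ℝ) (x : Fin K → Fin m → Bool) : ℝ :=
  d * (numOnes K m x : ℝ) + cova K m c x

/-- Chebyshev surrogate `β(x) = Var[W(x)] / (Var[W(x)] + (B − E[W(x)])²)`. -/
def chebBeta (K m : ℕ) (a d c B : ℝ) (x : Fin K → Fin m → Bool) : ℝ :=
  varWeight K m d c x / (varWeight K m d c x + (B - expWeight K m a x) ^ 2)

/-- A solution is feasible if `E[W(x)] < B` and `β(x) ≤ α`. -/
def feasible (K m : ℕ) (a d c B α : ℝ) (x : Fin K → Fin m → Bool) : Prop :=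
  expWeight K m a x < B ∧ chebBeta K m a d c B x ≤ α

/-- `β'(x) = β(x)` if `E[W(x)] < B`, and `β'(x) = 1 + E[W(x)] − B` otherwise. -/
def betaPrime (K m : ℕ) (a d c B : ℝ) (x : Fin K → Fin m → Bool) : ℝ :=
  if expWeight K m a x < B then chebBeta K m a d c B x else 1 + expWeight K m a x - B

/-- Total profit `p(x) = Σᵢⱼ p_{ij}·x_{ij}`. -/
def profitOf (K m : ℕ) (profit : Fin K → Fin m → ℝ) (x : Fin K → Fin m → Bool) : ℝ :=
  ∑ i, ∑ j, if x i j then profit i j else 0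

/-- `p'(x) = −1` if `β'(x) > α`, and `p'(x) = p(x)` otherwise. -/
def pPrime (K m : ℕ) (a d c B α : ℝ) (profit : Fin K → Fin m → ℝ)
    (x : Fin K → Fin m → Bool) : ℝ :=
  if α < betaPrime K m a d c B x then -1 else profitOf K m profit x

/-- Lexicographic fitness dominance: `f(y) ⪰ f(x)` iff `p'(y) > p'(x)`, or
`p'(y) = p'(x)` and `β'(y) ≤ β'(x)`. -/
def fge (K m : ℕ) (a d c B α : ℝ) (profit : Fin K → Fin m → ℝ)
    (y x : Fin K → Fin m → Bool) : Prop :=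
  pPrime K m a d c B α profit x < pPrime K m a d c B α profit y ∨
    (pPrime K m a d c B α profit y = pPrime K m a d c B α profit x ∧
      betaPrime K m a d c B y ≤ betaPrime K m a d c B x)

/-- Hamming distance between two solutions. -/
def hdist (K m : ℕ) (x y : Fin K → Fin m → Bool) : ℕ :=
  ∑ i, ∑ j, if x i j = y i j then 0 else 1

/-- Standard-bit mutation of the (1+1) EA: each bit flips independently with
probability `1/n`, so `y` is produced from `x` with probability
`(1/n)^{H(x,y)}·(1 − 1/n)^{n − H(x,y)}`. -/
def mutEA (K m : ℕ) (x y : Fin K → Fin m → Bool) : ℝ≥0∞ :=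
  (1 / (K * m : ℝ≥0∞)) ^ hdist K m x y *
    (1 - 1 / (K * m : ℝ≥0∞)) ^ (K * m - hdist K m x y)

/-- RLS mutation: with probability `1/2` flip one uniformly random bit, with probability
`1/2` flip a uniformly random pair of distinct bits; so a one-bit-flip neighbour is
produced with probability `1/(2n)` and a two-bit-flip neighbour with probability
`1/(n(n−1))`. -/
def mutRLS (K m : ℕ) (x y : Fin K → Fin m → Bool) : ℝ≥0∞ :=
  if hdist K m x y = 1 then 1 / (2 * (K * m : ℝ≥0∞))
  else if hdist K m x y = 2 then 1 / ((K * m : ℝ≥0∞) * ((K * m : ℝ≥0∞) - 1))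
  else 0

open scoped Classical in
/-- One-step transition probability of an elitist algorithm with mutation distribution
`mutD` and acceptance relation `acc y x` (= "`f(y) ⪰ f(x)`"): the offspring is accepted
iff `acc`, otherwise the algorithm stays at `x`. -/
def stepP (K m : ℕ)
    (mutD : (Fin K → Fin m → Bool) → (Fin K → Fin m → Bool) → ℝ≥0∞)
    (acc : (Fin K → Fin m → Bool) → (Fin K → Fin m → Bool) → Prop)
    (x y : Fin K → Fin m → Bool) : ℝ≥0∞ :=
  (if acc y x then mutD x y else 0) +
    (if y = x then ∑ z, (if acc z x then 0 else mutD x z) else 0)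

open scoped Classical in
/-- `hitVec K m P A x₀ t y` is the probability that the Markov chain with transition
matrix `P` started at `x₀` has not visited the target set `A` during the first `t` steps
and is currently at `y`. -/
def hitVec (K m : ℕ)
    (P : (Fin K → Fin m → Bool) → (Fin K → Fin m → Bool) → ℝ≥0∞)
    (A : (Fin K → Fin m → Bool) → Prop) (x₀ : Fin K → Fin m → Bool) :
    ℕ → (Fin K → Fin m → Bool) → ℝ≥0∞
  | 0 => fun y => if y = x₀ ∧ ¬ A y then 1 else 0
  | (t + 1) => fun y => if A y then 0 else ∑ x, hitVec K m P A x₀ t x * P x y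

/-- Expected hitting time `E[min {t : X_t ∈ A}]` of the target set `A` for the Markov
chain with transition matrix `P` started at `x₀`, computed as `Σ_{t≥0} Pr(T > t)`. -/
def expHitTime (K m : ℕ)
    (P : (Fin K → Fin m → Bool) → (Fin K → Fin m → Bool) → ℝ≥0∞)
    (A : (Fin K → Fin m → Bool) → Prop) (x₀ : Fin K → Fin m → Bool) : ℝ≥0∞ :=
  ∑' t : ℕ, ∑ y, hitVec K m P A x₀ t y

/-- Covariance `s_ℓ^b` of a balanced solution with `ℓ` one-bits: with `q = ⌊ℓ/K⌋` and
`t = ℓ − qK`, it is `c·[(K − t)·q(q − 1) + t·(q + 1)q]`. -/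
def balCov (K : ℕ) (c : ℝ) (ℓ : ℕ) : ℝ :=
  c * (((K - (ℓ - (ℓ / K) * K)) * ((ℓ / K) * (ℓ / K - 1)) +
        (ℓ - (ℓ / K) * K) * ((ℓ / K + 1) * (ℓ / K)) : ℕ) : ℝ)

/-- The solution obtained from `y` by setting bit `(i, j)` to one. -/
def flipUp (K m : ℕ) (y : Fin K → Fin m → Bool) (i : Fin K) (j : Fin m) :
    Fin K → Fin m → Bool :=
  fun i' j' => if i' = i ∧ j' = j then true else y i' j'

end
lemma mut_eq (K m : ℕ) (x y : Fin K → Fin m → Bool) :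
   mutEA K m x y = ∏ i, ∏ j, (if x i j = y i j then (1 - 1 / (K * m : ℝ≥0∞)) else 1 / (K * m : ℝ≥0∞)) := by
  have h1 : ∏ i, ∏ j, (if x i j = y i j then (1 - 1 / (K * m : ℝ≥0∞)) else 1 / (K * m : ℝ≥0∞))
     = (1 / (K * m : ℝ≥0∞)) ^ hdist K m x y * 
     (1 - 1 / (K * m : ℝ≥0∞)) ^ (∑ i, ∑ j, if x i j = y i j then 1 else 0) := by
    unfold hdist
    simp only [← Finset.prod_pow_eq_pow_sum, ← Finset.prod_mul_distrib]
    refine Finset.prod_congr rfl fun i _ => Finset.prod_congr rfl fun j _ => ?_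
    split_ifs <;> simp
  have h2 : (∑ i, ∑ j, if x i j = y i j then 1 else 0) + hdist K m x y = K * m := by
    unfold hdist
    simp only [← Finset.sum_add_distrib]
    have : ∀ i j, ((if x i j = y i j then 1 else 0) + if x i j = y i j then 0 else 1) = 1 := by
      intro i j; split_ifs <;> rfl
    simp [this]
  rw [h1, mutEA]
  congr 2
  omega

lemma mut_sum (K m : ℕ) (hn : 2 ≤ K * m) (x : Fin K → Fin m → Bool) :
    ∑ y, mutEA K m x y = 1 := by
  simp only [mut_eq]
  have := Finset.prod_univ_sum (fun _ : Fin K => (Finset.univ : Finset (Fin m → Bool)))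
    (fun i (z : Fin m → Bool) => ∏ j, (if x i j = z j then (1 - 1 / (K * m : ℝ≥0∞)) else 1 / (K * m : ℝ≥0∞)))
  rw [Fintype.piFinset_univ] at this
  rw [← this]
  refine Finset.prod_eq_one fun i _ => ?_
  have := Finset.prod_univ_sum (fun _ : Fin m => (Finset.univ : Finset Bool))
    (fun j (z : Bool) => (if x i j = z then (1 - 1 / (K * m : ℝ≥0∞)) else 1 / (K * m : ℝ≥0∞)))
  rw [Fintype.piFinset_univ] at this
  rw [← this]
  refine Finset.prod_eq_one fun j _ => ?_
  have h1 : (1 / (K * m : ℝ≥0∞)) ≤ 1 := by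
    rw [one_div]; apply ENNReal.inv_le_one.2
    exact_mod_cast (by omega : 1 ≤ K * m)
  rw [one_div] at h1
  cases x i j <;> simp
  · exact add_tsub_cancel_of_le h1
  · exact tsub_add_cancel_of_le h1

lemma hit_bound (K m : ℕ) (P : (Fin K → Fin m → Bool) → (Fin K → Fin m → Bool) → ℝ≥0∞)
    (A : (Fin K → Fin m → Bool) → Prop) (x₀ : Fin K → Fin m → Bool)
    (V : (Fin K → Fin m → Bool) → ℝ≥0∞)
    (hV : ∀ x, ¬ A x → ∑ y, P x y * V y + 1 ≤ V x) :
    expHitTime K m P A x₀ ≤ V x₀ := by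
  classical
  have hz : ∀ t x, A x → hitVec K m P A x₀ t x = 0 := by
    intro t x hx
    cases t <;> simp [hitVec, hx]
  have key : ∀ t, ∑ s ∈ Finset.range t, ∑ y, hitVec K m P A x₀ s y
      + ∑ y, hitVec K m P A x₀ t y * V y ≤ V x₀ := by
    intro t
    induction t with
    | zero =>
      simp only [Finset.range_zero, Finset.sum_empty, zero_add]
      rw [Finset.sum_eq_single x₀]
      · simp only [hitVec]; split_ifs <;> simp
      · intro b _ hb; simp [hitVec, hb]
      · simp
    | succ t ih =>
      refine le_trans ?_ ih
      rw [Finset.sum_range_succ, add_assoc]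
      gcongr
      have : ∑ y, hitVec K m P A x₀ (t+1) y * V y ≤
          ∑ y, ∑ x, hitVec K m P A x₀ t x * (P x y * V y) := by
        refine Finset.sum_le_sum fun y _ => ?_
        simp only [hitVec]
        split_ifs
        · simp
        · rw [Finset.sum_mul]; simp only [mul_assoc]; exact le_rfl
      refine (add_le_add_right this _).trans ?_
      rw [Finset.sum_comm, ← Finset.sum_add_distrib]
      refine Finset.sum_le_sum fun x _ => ?_
      by_cases hx : A x
      · simp [hz t x hx]
      · rw [← Finset.mul_sum]
        calc _ = hitVec K m P A x₀ t x * (∑ y, P x y * V y + 1) := by ring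
          _ ≤ _ := by gcongr; exact hV x hx
  unfold expHitTime
  rw [ENNReal.tsum_eq_iSup_nat]
  exact iSup_le fun t => le_trans le_self_add (key t)

def setF (K m : ℕ) (x : Fin K → Fin m → Bool) (q : Fin K × Fin m) : Fin K → Fin m → Bool :=
  fun i j => if i = q.1 ∧ j = q.2 then false else x i j

lemma setF_inj (K m : ℕ) (x : Fin K → Fin m → Bool) (q q' : Fin K × Fin m)
   (h : x q.1 q.2 = true) (e : setF K m x q = setF K m x q') : q = q' := by
  have := congrFun (congrFun e q.1) q.2
  simp [setF, h] at this
  exact Prod.ext this.1 this.2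

lemma setF_hdist (K m : ℕ) (x : Fin K → Fin m → Bool) (q : Fin K × Fin m)
   (h : x q.1 q.2 = true) : hdist K m x (setF K m x q) = 1 := by
  unfold hdist
  rw [Finset.sum_eq_single q.1, Finset.sum_eq_single q.2]
  · simp [setF, h]
  · intro j _ hj; simp [setF, hj]
  · simp
  · intro i _ hi; simp [setF, hi]
  · simp

lemma setF_numOnes (K m : ℕ) (x : Fin K → Fin m → Bool) (q : Fin K × Fin m)
   (h : x q.1 q.2 = true) : numOnes K m (setF K m x q) + 1 = numOnes K m x := by
  have := setF_hdist K m x q h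
  rw [← this]
  unfold numOnes hdist
  simp only [← Finset.sum_add_distrib]
  refine Finset.sum_congr rfl fun i _ => Finset.sum_congr rfl fun j _ => ?_
  by_cases hq : i = q.1 ∧ j = q.2
  · obtain ⟨rfl, rfl⟩ := hq; simp [setF, h]
  · simp [setF, hq]

lemma setF_mut (K m : ℕ) (hn : 2 ≤ K * m) (x : Fin K → Fin m → Bool) (q : Fin K × Fin m)
   (h : x q.1 q.2 = true) :
   ENNReal.ofReal (1 / (3 * (K * m : ℝ))) ≤ mutEA K m x (setF K m x q) := by
  unfold mutEA
  rw [setF_hdist K m x q h, pow_one]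
  obtain ⟨n, hn'⟩ : ∃ n, K * m = n + 2 := ⟨K * m - 2, by omega⟩
  have e1 : (K * m : ℝ≥0∞) = ENNReal.ofReal ((n:ℝ) + 2) := by
    have : (K * m : ℝ≥0∞) = ((n + 2 : ℕ) : ℝ≥0∞) := by rw [← hn']; push_cast; rfl
    rw [this, ← ENNReal.ofReal_natCast]; push_cast; rfl
  have e2 : (K * m : ℝ) = (n:ℝ) + 2 := by exact_mod_cast hn'
  have hp : (0:ℝ) < (n:ℝ) + 2 := by positivity
  rw [e1, e2, hn', show n + 2 - 1 = n + 1 by omega, ← ENNReal.ofReal_one, ← ENNReal.ofReal_div_of_pos hp,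
    ← ENNReal.ofReal_sub _ (by positivity)]
  have e3 : (1 - 1 / ((n:ℝ)+2)) = (1 + 1 / ((n:ℝ)+1))⁻¹ := by field_simp; ring
  rw [e3, ← ENNReal.ofReal_pow (by positivity), ← ENNReal.ofReal_mul (by positivity)]
  apply ENNReal.ofReal_le_ofReal
  have h3 : (1 + 1 / ((n:ℝ)+1)) ^ (n+1) ≤ 3 := by
    calc (1 + 1 / ((n:ℝ)+1)) ^ (n+1) ≤ (Real.exp (1 / ((n:ℝ)+1)))^(n+1) := by
          gcongr; rw [add_comm]; exact Real.add_one_le_exp _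
      _ = Real.exp 1 := by
          rw [← Real.exp_nat_mul]; congr 1; push_cast; field_simp
      _ ≤ 3 := by linarith [Real.exp_one_lt_d9]
  rw [inv_pow, one_div, mul_comm 3, mul_inv, one_div]
  gcongr

lemma drift (K m : ℕ) (hn : 2 ≤ K * m)
    (acc : (Fin K → Fin m → Bool) → (Fin K → Fin m → Bool) → Prop)
    (V : (Fin K → Fin m → Bool) → ℝ) (x : Fin K → Fin m → Bool) 
    (δ : Fin K × Fin m → ℝ)
    (hmono : ∀ y, acc y x → V y ≤ V x)
    (hacc : ∀ q : Fin K × Fin m, x q.1 q.2 = true → acc (setF K m x q) x)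
    (h0 : ∀ q, 0 ≤ δ q)
    (hδ0 : ∀ q : Fin K × Fin m, x q.1 q.2 = false → δ q = 0)
    (hδ : ∀ q : Fin K × Fin m, x q.1 q.2 = true → V (setF K m x q) + δ q ≤ V x)
    (hV0 : ∀ x, 0 ≤ V x)
    (hs : 3 * (K * m : ℝ) ≤ ∑ q, δ q) :
    ∑ y, stepP K m (mutEA K m) acc x y * ENNReal.ofReal (V y) + 1 ≤ ENNReal.ofReal (V x) := by
  classical
  set W : (Fin K → Fin m → Bool) → ℝ := fun y => if acc y x then V y else V x with hW
  have hWx : ∀ y, W y ≤ V x := by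
    intro y; simp only [hW]; split_ifs with h
    · exact hmono y h
    · exact le_rfl
  have hW0 : ∀ y, 0 ≤ W y := by
    intro y; simp only [hW]; split_ifs <;> exact hV0 _
  have e1 : ∑ y, stepP K m (mutEA K m) acc x y * ENNReal.ofReal (V y) =
      ∑ y, mutEA K m x y * ENNReal.ofReal (W y) := by
    simp only [stepP, add_mul, Finset.sum_add_distrib, ite_mul, zero_mul, Finset.sum_ite_eq',
      Finset.mem_univ, if_true]
    rw [Finset.sum_mul, ← Finset.sum_add_distrib]
    refine Finset.sum_congr rfl fun y _ => ?_
    simp only [hW]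
    split_ifs <;> simp
  have e2 : ENNReal.ofReal (V x) = ∑ y, mutEA K m x y * ENNReal.ofReal (W y) +
      ∑ y, mutEA K m x y * ENNReal.ofReal (V x - W y) := by
    rw [← Finset.sum_add_distrib]
    simp only [← mul_add]
    have : ∀ y, ENNReal.ofReal (W y) + ENNReal.ofReal (V x - W y) = ENNReal.ofReal (V x) := by
      intro y
      rw [← ENNReal.ofReal_add (hW0 y) (by linarith [hWx y])]; congr 1; ring
    simp only [this]
    rw [← Finset.sum_mul, mut_sum K m hn, one_mul]
  rw [e1, e2]
  gcongr
  have hpos : (0:ℝ) < K * m := by exact_mod_cast (by omega : 0 < K * m)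
  set S := Finset.univ.filter (fun q : Fin K × Fin m => x q.1 q.2 = true) with hS
  calc (1:ℝ≥0∞) = ENNReal.ofReal 1 := by simp
    _ ≤ ENNReal.ofReal (∑ q ∈ S, 1 / (3 * (K * m : ℝ)) * δ q) := by
        apply ENNReal.ofReal_le_ofReal
        rw [← Finset.mul_sum]
        have : ∑ q ∈ S, δ q = ∑ q, δ q := by
          apply Finset.sum_subset (Finset.subset_univ _)
          intro q _ hq
          apply hδ0; simpa [hS] using hq
        rw [this, one_div, ← div_eq_inv_mul, le_div_iff₀ (by positivity)]
        linarith
    _ = ∑ q ∈ S, ENNReal.ofReal (1 / (3 * (K * m : ℝ)) * δ q) := by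
        rw [ENNReal.ofReal_sum_of_nonneg]
        intro q _; have := h0 q; positivity
    _ ≤ ∑ q ∈ S, mutEA K m x (setF K m x q) * ENNReal.ofReal (V x - W (setF K m x q)) := by
        refine Finset.sum_le_sum fun q hq => ?_
        have hq' : x q.1 q.2 = true := by simpa [hS] using hq
        rw [ENNReal.ofReal_mul (by positivity)]
        gcongr
        · exact setF_mut K m hn x q hq'
        · simp only [hW, hacc q hq', if_true]; linarith [hδ q hq']
    _ = ∑ y ∈ S.image (setF K m x), mutEA K m x y * ENNReal.ofReal (V x - W y) := by
        rw [Finset.sum_image]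
        intro q hq q' _ e
        have hq' : x q.1 q.2 = true := by simpa [hS] using hq
        exact setF_inj K m x q q' hq' e
    _ ≤ _ := Finset.sum_le_sum_of_subset (Finset.subset_univ _)

lemma setF_false (K m : ℕ) (x : Fin K → Fin m → Bool) (q : Fin K × Fin m)
   (h : x q.1 q.2 = false) : setF K m x q = x := by
  funext i j
  by_cases hq : i = q.1 ∧ j = q.2
  · obtain ⟨rfl, rfl⟩ := hq; simp [setF, h]
  · simp [setF, hq]

lemma numOnes_le (K m : ℕ) (x : Fin K → Fin m → Bool) : (numOnes K m x : ℝ) ≤ K * m := by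
  have : numOnes K m x ≤ ∑ i : Fin K, ∑ j : Fin m, 1 := by
    unfold numOnes
    refine Finset.sum_le_sum fun i _ => Finset.sum_le_sum fun j _ => ?_
    split_ifs <;> simp
  simp at this
  exact_mod_cast this

lemma numOnes_sum (K m : ℕ) (x : Fin K → Fin m → Bool) :
    (numOnes K m x : ℝ) = ∑ q : Fin K × Fin m, if x q.1 q.2 then (1:ℝ) else 0 := by
  unfold numOnes
  rw [Fintype.sum_prod_type]
  push_cast
  rfl

lemma numOnes_setF_le (K m : ℕ) (x : Fin K → Fin m → Bool) (q : Fin K × Fin m) :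
    numOnes K m (setF K m x q) ≤ numOnes K m x := by
  cases h : x q.1 q.2
  · rw [setF_false K m x q h]
  · have := setF_numOnes K m x q h; omega

lemma cova_nonneg (K m : ℕ) (c : ℝ) (hc : 0 < c) (x : Fin K → Fin m → Bool) :
    0 ≤ cova K m c x := by
  unfold cova
  apply mul_nonneg (by positivity)
  refine Finset.sum_nonneg fun i _ => Finset.sum_nonneg fun p _ => ?_
  split_ifs <;> simp

lemma cova_le (K m : ℕ) (c : ℝ) (hc : 0 < c) (x : Fin K → Fin m → Bool) :
    cova K m c x ≤ 2 * c * (K * m : ℝ) ^ 2 := by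
  unfold cova
  gcongr
  calc _ ≤ ∑ i : Fin K, ∑ p : Fin m × Fin m, (1:ℝ) := by
        refine Finset.sum_le_sum fun i _ => ?_
        refine le_trans (Finset.sum_le_sum (g := fun _ => (1:ℝ)) fun p _ => ?_)
          (Finset.sum_le_sum_of_subset_of_nonneg (Finset.subset_univ _) (by simp))
        split_ifs <;> simp
    _ = K * (m:ℝ) ^ 2 := by simp [sq]
    _ ≤ (K:ℝ) ^ 2 * (m:ℝ) ^ 2 := by
        gcongr
        exact_mod_cast Nat.le_self_pow (by norm_num) K
    _ = _ := by ring

lemma cova_term (K m : ℕ) (x : Fin K → Fin m → Bool) (q : Fin K × Fin m) (i : Fin K)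
    (p : Fin m × Fin m) :
    (if i = q.1 ∧ p.1 = q.2 then
      (if x i p.1 then (1 : ℝ) else 0) * (if x i p.2 then (1 : ℝ) else 0) else 0) ≤
    (if x i p.1 then (1 : ℝ) else 0) * (if x i p.2 then (1 : ℝ) else 0) -
     (if setF K m x q i p.1 then (1 : ℝ) else 0) * (if setF K m x q i p.2 then (1 : ℝ) else 0) := by
  unfold setF
  cases x i p.1 <;> cases x i p.2 <;> by_cases h1 : i = q.1 ∧ p.1 = q.2 <;>
    by_cases h2 : i = q.1 ∧ p.2 = q.2 <;> simp only [h1, h2, if_true, if_false] <;>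
    first | norm_num; done | (split_ifs <;> simp_all)

lemma cova_setF_le (K m : ℕ) (c : ℝ) (hc : 0 < c) (x : Fin K → Fin m → Bool) (q : Fin K × Fin m) :
    cova K m c (setF K m x q) ≤ cova K m c x := by
  unfold cova
  gcongr 2 * c * ?_
  refine Finset.sum_le_sum fun i _ => Finset.sum_le_sum fun p _ => ?_
  have := cova_term K m x q i p
  have h2 : 0 ≤ (if i = q.1 ∧ p.1 = q.2 then
      (if x i p.1 then (1 : ℝ) else 0) * (if x i p.2 then (1 : ℝ) else 0) else 0) := by
    split_ifs <;> simp
  linarith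

lemma cova_sum (K m : ℕ) (c : ℝ) (hc : 0 < c) (x : Fin K → Fin m → Bool) :
    cova K m c x ≤ ∑ q, (cova K m c x - cova K m c (setF K m x q)) := by
  unfold cova
  simp only [← mul_sub, ← Finset.mul_sum, ← Finset.sum_sub_distrib]
  gcongr 2 * c * ?_
  conv_rhs => rw [Finset.sum_comm]
  refine Finset.sum_le_sum fun i _ => ?_
  conv_rhs => rw [Finset.sum_comm]
  refine Finset.sum_le_sum fun p _ => ?_
  calc _ = ∑ q : Fin K × Fin m, (if i = q.1 ∧ p.1 = q.2 then
      (if x i p.1 then (1 : ℝ) else 0) * (if x i p.2 then (1 : ℝ) else 0) else 0) := by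
        rw [Finset.sum_eq_single (i, p.1)]
        · simp
        · intro q _ hq
          rw [if_neg]
          rintro ⟨rfl, h⟩
          exact hq (by rw [h])
        · simp
    _ ≤ _ := Finset.sum_le_sum fun q _ => cova_term K m x q i p

lemma numOnes_drop (K m : ℕ) (x : Fin K → Fin m → Bool) (q : Fin K × Fin m) :
    (numOnes K m x : ℝ) - numOnes K m (setF K m x q) = if x q.1 q.2 then 1 else 0 := by
  cases h : x q.1 q.2
  · simp [setF_false K m x q h]
  · rw [← setF_numOnes K m x q h]; simp

lemma var_setF_le (K m : ℕ) (c d : ℝ) (hc : 0 < c) (hd : 0 < d) (x : Fin K → Fin m → Bool)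
    (q : Fin K × Fin m) : varWeight K m d c (setF K m x q) ≤ varWeight K m d c x := by
  unfold varWeight
  have h1 := cova_setF_le K m c hc x q
  have h2 : (numOnes K m (setF K m x q) : ℝ) ≤ numOnes K m x := by
    exact_mod_cast numOnes_setF_le K m x q
  gcongr

lemma var_sum (K m : ℕ) (c d : ℝ) (hc : 0 < c) (x : Fin K → Fin m → Bool) :
    varWeight K m d c x ≤ ∑ q, (varWeight K m d c x - varWeight K m d c (setF K m x q)) := by
  have h : ∀ q, varWeight K m d c x - varWeight K m d c (setF K m x q) =
      d * (if x q.1 q.2 then (1:ℝ) else 0) + (cova K m c x - cova K m c (setF K m x q)) := by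
    intro q; rw [← numOnes_drop K m x q]; unfold varWeight; ring
  simp only [h]
  rw [Finset.sum_add_distrib, ← Finset.mul_sum, ← numOnes_sum]
  have := cova_sum K m c hc x
  unfold varWeight; linarith

lemma var_ge (K m : ℕ) (c d : ℝ) (hc : 0 < c) (x : Fin K → Fin m → Bool) :
    d * numOnes K m x ≤ varWeight K m d c x := by
  have := cova_nonneg K m c hc x
  unfold varWeight; linarith

lemma var_le (K m : ℕ) (c d : ℝ) (hc : 0 < c) (hd : 0 < d) (hn : 2 ≤ K * m)
    (x : Fin K → Fin m → Bool) :
    varWeight K m d c x ≤ (d + 2 * c) * (K * m : ℝ) ^ 2 := by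
  have h1 := cova_le K m c hc x
  have h2 := numOnes_le K m x
  have h3 : (2:ℝ) ≤ K * m := by exact_mod_cast hn
  have h4 : (K * m : ℝ) ≤ (K * m : ℝ) ^ 2 := by nlinarith
  have : d * numOnes K m x ≤ d * (K * m : ℝ)^2 := by gcongr; linarith
  unfold varWeight; linarith

lemma var_zero (K m : ℕ) (c d : ℝ) (x : Fin K → Fin m → Bool)
    (h : numOnes K m x = 0) : varWeight K m d c x = 0 := by
  have hx : ∀ i j, x i j = false := by
    unfold numOnes at h
    simpa using h
  unfold varWeight cova
  simp [h, hx]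

/-- Potential as a function of the number of ones and the variance. -/
noncomputable def Gp (b Q M l v : ℝ) : ℝ := if l < b then v / max ((b - l) ^ 2) (1 / Q) else M * l

lemma cheb_le_iff {v1 s1 v2 s2 : ℝ} (h1 : 0 ≤ v1) (h2 : 0 ≤ v2) (hs1 : 0 < s1) (hs2 : 0 < s2) :
    v1 / (v1 + s1 ^ 2) ≤ v2 / (v2 + s2 ^ 2) ↔ v1 * s2 ^ 2 ≤ v2 * s1 ^ 2 := by
  rw [div_le_div_iff₀ (by positivity) (by positivity)]
  constructor <;> intro h <;> nlinarith

lemma cheb_lt_one {v1 s1 : ℝ} (h1 : 0 ≤ v1) (hs1 : 0 < s1) : v1 / (v1 + s1 ^ 2) < 1 := by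
  rw [div_lt_one (by positivity)]
  have : 0 < s1 ^ 2 := by positivity
  linarith

lemma bp_eq (K m : ℕ) (a d c B : ℝ) (ha : 0 < a) (x : Fin K → Fin m → Bool) :
    betaPrime K m a d c B x = if (numOnes K m x : ℝ) < B / a then
      varWeight K m d c x / (varWeight K m d c x + (a * (B / a - numOnes K m x)) ^ 2)
      else 1 - a * (B / a - numOnes K m x) := by
  unfold betaPrime chebBeta expWeight
  have e : a * (B / a - numOnes K m x) = B - a * numOnes K m x := by field_simp
  rw [e]
  have : (a * (numOnes K m x : ℝ) < B) ↔ (numOnes K m x : ℝ) < B / a := by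
    rw [lt_div_iff₀ ha, mul_comm]
  simp only [this]
  split_ifs <;> ring

lemma bp_le (K m : ℕ) (a d c B : ℝ) (ha : 0 < a) (hd : 0 < d) (hc : 0 < c) (x y : Fin K → Fin m → Bool)
    (hl : numOnes K m y ≤ numOnes K m x) (hv : varWeight K m d c y ≤ varWeight K m d c x) :
    betaPrime K m a d c B y ≤ betaPrime K m a d c B x := by
  have hvy : 0 ≤ varWeight K m d c y := le_trans (by positivity) (var_ge K m c d hc y)
  have hl' : (numOnes K m y : ℝ) ≤ numOnes K m x := by exact_mod_cast hl
  rw [bp_eq K m a d c B ha, bp_eq K m a d c B ha]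
  split_ifs with h1 h2 h2
  · rw [cheb_le_iff hvy (by linarith) (mul_pos ha (by linarith)) (mul_pos ha (by linarith))]
    have : 0 < B / a - numOnes K m x := by linarith
    have := hvy.trans hv
    gcongr
  · have := cheb_lt_one hvy (mul_pos ha (by linarith : 0 < B / a - numOnes K m y))
    have : a * (B / a - numOnes K m x) ≤ 0 := mul_nonpos_of_nonneg_of_nonpos ha.le (by linarith)
    linarith
  · linarith
  · gcongr

lemma Gp_le_M {b Q vm l v : ℝ} (hQ : 1 ≤ Q) (hv : 0 ≤ v) (hvm : v ≤ vm) (h : l < b) :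
    Gp b Q (Q * vm) l v ≤ Q * vm := by
  unfold Gp
  rw [if_pos h, div_le_iff₀ (lt_max_of_lt_right (by positivity))]
  have : 1 / Q ≤ max ((b - l) ^ 2) (1 / Q) := le_max_right _ _
  calc v ≤ vm := hvm
    _ = Q * vm * (1 / Q) := by field_simp
    _ ≤ _ := by gcongr; nlinarith

lemma bp_mono (K m : ℕ) (a d c B : ℝ) (ha : 0 < a) (hd : 0 < d) (hc : 0 < c) 
    (x y : Fin K → Fin m → Bool) (Q vm : ℝ) (hQ : 1 ≤ Q) (hQd : vm = Q * d)
    (hvm : ∀ z, varWeight K m d c z ≤ vm)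
    (hl : 1 ≤ numOnes K m x) 
    (h : betaPrime K m a d c B y ≤ betaPrime K m a d c B x) :
    Gp (B / a) Q (Q * vm) (numOnes K m y) (varWeight K m d c y) ≤ 
    Gp (B / a) Q (Q * vm) (numOnes K m x) (varWeight K m d c x) := by
  have hvy : 0 ≤ varWeight K m d c y := le_trans (by positivity) (var_ge K m c d hc y)
  have hvx : 0 ≤ varWeight K m d c x := le_trans (by positivity) (var_ge K m c d hc x)
  have hM : 0 ≤ Q * vm := by rw [hQd]; positivity
  have hl' : (1:ℝ) ≤ numOnes K m x := by exact_mod_cast hl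
  rw [bp_eq K m a d c B ha, bp_eq K m a d c B ha] at h
  set b := B / a
  have hvdx := var_ge K m c d hc x
  by_cases hx : (numOnes K m x : ℝ) < b
  · by_cases hy : (numOnes K m y : ℝ) < b
    · rw [if_pos hx, if_pos hy, cheb_le_iff hvy hvx (mul_pos ha (by linarith)) (mul_pos ha (by linarith)),
        mul_pow, mul_pow] at h
      have h : varWeight K m d c y * (b - numOnes K m x)^2 ≤ varWeight K m d c x * (b - numOnes K m y)^2 := by
        have : 0 < a ^ 2 := by positivity
        nlinarith
      unfold Gp
      rw [if_pos hx, if_pos hy, div_le_div_iff₀ (lt_max_of_lt_right (by positivity)) (lt_max_of_lt_right (by positivity))]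
      by_cases hs : 1 / Q ≤ (b - numOnes K m x)^2
      · rw [max_eq_left hs]
        exact h.trans (by gcongr; exact le_max_left _ _)
      · push Not at hs
        rw [max_eq_right hs.le]
        have h1 : b - numOnes K m x < 1 := by
          have : 1 / Q ≤ 1 := by rw [div_le_one (by positivity)]; exact hQ
          nlinarith
        have h2 : numOnes K m y < numOnes K m x + 1 := by
          have : (numOnes K m y : ℝ) < numOnes K m x + 1 := by linarith
          exact_mod_cast this
        rcases Nat.lt_succ_iff_lt_or_eq.1 h2 with h3 | h3
        · have h3' : (numOnes K m y : ℝ) + 1 ≤ numOnes K m x := by exact_mod_cast h3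
          have h4 : 1 ≤ max ((b - numOnes K m y)^2) (1 / Q) := le_max_of_le_left (by nlinarith)
          calc _ ≤ vm * (1 / Q) := by gcongr; exact hvm y
            _ = d := by rw [hQd]; field_simp
            _ ≤ varWeight K m d c x := by nlinarith
            _ ≤ _ := by nlinarith
        · rw [h3] at h ⊢
          have h4 : varWeight K m d c y ≤ varWeight K m d c x := 
            le_of_mul_le_mul_right h (by have : 0 < b - numOnes K m x := by linarith
                                         positivity)
          gcongr
          exact le_max_right _ _
    · exfalso
      rw [if_pos hx, if_neg hy] at h
      have := cheb_lt_one hvx (mul_pos ha (by linarith : 0 < b - numOnes K m x))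
      have : a * (b - numOnes K m y) ≤ 0 := mul_nonpos_of_nonneg_of_nonpos ha.le (by linarith)
      linarith
  · by_cases hy : (numOnes K m y : ℝ) < b
    · refine (Gp_le_M hQ hvy (hvm y) hy).trans ?_
      unfold Gp
      rw [if_neg hx]
      nlinarith
    · rw [if_neg hx, if_neg hy] at h
      unfold Gp
      rw [if_neg hx, if_neg hy]
      have : (numOnes K m y : ℝ) ≤ numOnes K m x := by
        by_contra hh; push Not at hh
        nlinarith
      gcongr

lemma Gp_sum (K m : ℕ) (b d c : ℝ) (hd : 0 < d) (hc : 0 < c) 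
    (x : Fin K → Fin m → Bool) (Q vm : ℝ) (hQ : 1 ≤ Q) (hQd : vm = Q * d)
    (hvm : ∀ z, varWeight K m d c z ≤ vm) :
    Gp b Q (Q * vm) (numOnes K m x) (varWeight K m d c x) ≤ 
    ∑ q, (Gp b Q (Q * vm) (numOnes K m x) (varWeight K m d c x) - 
     Gp b Q (Q * vm) (numOnes K m (setF K m x q)) (varWeight K m d c (setF K m x q))) := by
  have hv0 : ∀ y, 0 ≤ varWeight K m d c y := fun y => le_trans (by positivity) (var_ge K m c d hc y)
  have hM : 0 ≤ Q * vm := by rw [hQd]; positivity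
  have hle : ∀ q, (numOnes K m (setF K m x q) : ℝ) ≤ numOnes K m x := by
    intro q; exact_mod_cast numOnes_setF_le K m x q
  by_cases hx : (numOnes K m x : ℝ) < b
  · set D := max ((b - numOnes K m x) ^ 2) (1 / Q) with hD
    have hD0 : 0 < D := lt_max_of_lt_right (by positivity)
    have hG : Gp b Q (Q * vm) (numOnes K m x) (varWeight K m d c x) = varWeight K m d c x / D := by
      unfold Gp; rw [if_pos hx]
    calc _ = varWeight K m d c x / D := hG
      _ ≤ (∑ q, (varWeight K m d c x - varWeight K m d c (setF K m x q))) / D := by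
          gcongr; exact var_sum K m c d hc x
      _ = ∑ q, (varWeight K m d c x / D - varWeight K m d c (setF K m x q) / D) := by
          rw [Finset.sum_div]; simp only [sub_div]
      _ ≤ _ := by
          refine Finset.sum_le_sum fun q _ => ?_
          rw [hG]
          gcongr
          unfold Gp
          rw [if_pos (lt_of_le_of_lt (hle q) hx)]
          have := hv0 (setF K m x q)
          have h3 : 0 < b - numOnes K m x := by linarith
          have h4 := hle q
          gcongr
          rw [hD]
          gcongr
  · have hG : Gp b Q (Q * vm) (numOnes K m x) (varWeight K m d c x) = Q * vm * numOnes K m x := by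
      unfold Gp; rw [if_neg hx]
    calc _ = Q * vm * numOnes K m x := hG
      _ = ∑ q : Fin K × Fin m, Q * vm * (if x q.1 q.2 then (1:ℝ) else 0) := by
          rw [numOnes_sum, Finset.mul_sum]
      _ ≤ _ := by
          refine Finset.sum_le_sum fun q _ => ?_
          cases h : x q.1 q.2
          · simp [setF_false K m x q h]
          · have h1 := setF_numOnes K m x q h
            have h1' : (numOnes K m (setF K m x q) : ℝ) + 1 = numOnes K m x := by exact_mod_cast h1
            rw [hG, ← h1']
            simp only [if_true]
            suffices Gp b Q (Q * vm) (numOnes K m (setF K m x q)) (varWeight K m d c (setF K m x q)) ≤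
              Q * vm * numOnes K m (setF K m x q) by linarith
            by_cases hy : (numOnes K m (setF K m x q) : ℝ) < b
            · rcases Nat.eq_zero_or_pos (numOnes K m (setF K m x q)) with h0 | h0
              · unfold Gp; rw [if_pos hy, var_zero K m c d _ h0, h0]; simp
              · refine (Gp_le_M hQ (hv0 _) (hvm _) hy).trans ?_
                have : (1:ℝ) ≤ numOnes K m (setF K m x q) := by exact_mod_cast h0
                nlinarith
            · unfold Gp; rw [if_neg hy]

lemma Gp_bounds (b d n Q vm l v : ℝ) (hn : 2 ≤ n) (hd : 0 < d) (hQ : 1 ≤ Q) (hQd : vm = Q * d)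
    (hl : 1 ≤ l) (hln : l ≤ n) (hv : d * l ≤ v) (hvm : v ≤ vm) :
    d ≤ Gp b Q (Q * vm) l v * (max b 1) ^ 2 ∧ Gp b Q (Q * vm) l v * (max b 1) ^ 2 ≤ vm * Q * n ^ 4 := by
  have hvm0 : 0 ≤ vm := by rw [hQd]; positivity
  have hdv : d ≤ v := by nlinarith
  unfold Gp
  split_ifs with h
  · have hb : 1 < b := by linarith
    rw [max_eq_left hb.le]
    have hD : max ((b - l)^2) (1 / Q) ≤ b ^ 2 := by
      apply max_le
      · nlinarith
      · calc 1 / Q ≤ 1 := by rw [div_le_one (by positivity)]; exact hQ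
          _ ≤ _ := by nlinarith
    have hD0 : 0 < max ((b - l)^2) (1 / Q) := lt_max_of_lt_right (by positivity)
    have hD2 : b ^ 2 ≤ max ((b - l)^2) (1 / Q) * (Q * (n+1)^2) := by
      by_cases hbn : b ≤ n + 1
      · calc b ^ 2 ≤ (n+1)^2 := by gcongr
          _ = 1 / Q * (Q * (n+1)^2) := by field_simp
          _ ≤ _ := by gcongr; exact le_max_right _ _
      · push Not at hbn
        have h1 : b ≤ (b - l) * (n + 1) := by nlinarith
        calc b ^ 2 ≤ ((b - l) * (n + 1))^2 := by gcongr
          _ = (b-l)^2 * (1 * (n+1)^2) := by ring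
          _ ≤ _ := by gcongr; exact le_max_left _ _
    have hn4 : (n+1)^2 ≤ n^4 := by
      have : n + 1 ≤ n ^ 2 := by nlinarith
      calc (n+1)^2 ≤ (n^2)^2 := by gcongr
        _ = _ := by ring
    rw [div_mul_eq_mul_div]
    constructor
    · rw [le_div_iff₀ hD0]; have hv0 : 0 ≤ v := by linarith
      gcongr
    · rw [div_le_iff₀ hD0]
      have hv0 : 0 ≤ v := by linarith
      calc v * b ^ 2 ≤ vm * (max ((b - l)^2) (1 / Q) * (Q * (n+1)^2)) := by gcongr
        _ ≤ vm * (max ((b - l)^2) (1 / Q) * (Q * n^4)) := by gcongr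
        _ = _ := by ring
  · push Not at h
    have h1 : max b 1 ≤ n := max_le (by linarith) (by linarith)
    have h2 : 1 ≤ max b 1 := le_max_right _ _
    constructor
    · calc d ≤ vm := by linarith
        _ = 1 * vm * 1 * 1 ^ 2 := by ring
        _ ≤ _ := by gcongr
    · calc Q * vm * l * (max b 1)^2 ≤ Q * vm * n * n ^ 2 := by gcongr
        _ = vm * Q * n ^ 3 := by ring
        _ ≤ _ := by gcongr <;> linarith

lemma feas_iff (K m : ℕ) (a d c B α : ℝ) (hα : α < 1) (x : Fin K → Fin m → Bool) :
    feasible K m a d c B α x ↔ ¬ α < betaPrime K m a d c B x := by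
  unfold feasible betaPrime
  split_ifs with h
  · simp [h]
  · constructor
    · intro h'; exact absurd h'.1 h
    · intro h'; exfalso; apply h'; push Not at h; linarith

lemma ones_pos (K m : ℕ) (a d c B α : ℝ) (hB : 0 < B) (hα : 0 < α) (x : Fin K → Fin m → Bool)
    (h : ¬ feasible K m a d c B α x) : 1 ≤ numOnes K m x := by
  by_contra hh
  have h0 : numOnes K m x = 0 := by omega
  apply h
  unfold feasible chebBeta expWeight
  rw [var_zero K m c d x h0, h0]
  simp [hB, hα.le]

lemma fge_mono (K m : ℕ) (a d c B α : ℝ) (profit : Fin K → Fin m → ℝ) (hα : α < 1)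
    (x y : Fin K → Fin m → Bool) (hx : ¬ feasible K m a d c B α x) (hy : ¬ feasible K m a d c B α y) :
    fge K m a d c B α profit y x ↔ betaPrime K m a d c B y ≤ betaPrime K m a d c B x := by
  rw [feas_iff K m a d c B α hα, not_not] at hx hy
  unfold fge pPrime
  rw [if_pos hx, if_pos hy]; simp

lemma fge_feas (K m : ℕ) (a d c B α : ℝ) (profit : Fin K → Fin m → ℝ) (hα : α < 1)
    (hp : ∀ i j, 0 ≤ profit i j)
    (x y : Fin K → Fin m → Bool) (hx : ¬ feasible K m a d c B α x) (hy : feasible K m a d c B α y) :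
    fge K m a d c B α profit y x := by
  rw [feas_iff K m a d c B α hα] at hx hy
  rw [not_not] at hx
  unfold fge pPrime
  rw [if_pos hx, if_neg hy]
  left
  have : 0 ≤ profitOf K m profit y := by
    unfold profitOf
    refine Finset.sum_nonneg fun i _ => Finset.sum_nonneg fun j _ => ?_
    split_ifs
    · exact hp i j
    · exact le_rfl
  linarith


/-- (1+1) EA on the chance-constrained knapsack problem with correlated uniform weights,
`n = K·m ≥ 2`: there is a constant `C > 0` depending only on `c` and `d` such that, from
every initial solution, the expected number of iterations until the current solution is
feasible for the first time is at most `C·n²·(1 + log n)`. -/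
theorem EA_finds_feasible (c d : ℝ) (hc : 0 < c) (hd : 0 < d) :
    ∃ C : ℝ, 0 < C ∧
      ∀ (K m : ℕ), 1 ≤ K → 1 ≤ m → 2 ≤ K * m →
      ∀ (a B α : ℝ), 0 < a → 0 < B → 0 < α → α < 1 →
      ∀ (profit : Fin K → Fin m → ℝ), (∀ i j, 0 ≤ profit i j) →
      ∀ x₀ : Fin K → Fin m → Bool,
        expHitTime K m
            (stepP K m (mutEA K m) (fge K m a d c B α profit))
            (feasible K m a d c B α) x₀ ≤
          ENNReal.ofReal (C * (K * m : ℝ) ^ 2 * (1 + Real.log (K * m : ℝ))) := by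
  classical
  have hlog0 : 0 ≤ Real.log (1 + 2 * c / d) := Real.log_nonneg (by have : 0 < 2 * c / d := by positivity
                                                                   linarith)
  refine ⟨3 * (9 + 2 * Real.log (1 + 2 * c / d)), by positivity, ?_⟩
  intro K m hK hm hn a B α ha hB hα hα1 profit hp x₀
  set n : ℝ := (K * m : ℝ) with hndef
  have hn2 : (2:ℝ) ≤ n := by rw [hndef]; exact_mod_cast hn
  set κ : ℝ := 1 + 2 * c / d with hκ
  have hκ1 : 1 ≤ κ := by have : 0 < 2 * c / d := by positivity
                         linarith
  set Q : ℝ := κ * n ^ 2 with hQdef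
  set vm : ℝ := Q * d with hvmdef
  have hQ : 1 ≤ Q := by rw [hQdef]; nlinarith
  have hvm : ∀ z, varWeight K m d c z ≤ vm := by
    intro z
    refine (var_le K m c d hc hd hn z).trans (le_of_eq ?_)
    rw [hvmdef, hQdef, hκ, ← hndef]; field_simp
  set b := B / a with hb
  set G : (Fin K → Fin m → Bool) → ℝ := fun z =>
    Gp b Q (Q * vm) (numOnes K m z) (varWeight K m d c z) with hG
  set F := feasible K m a d c B α with hF
  set V : (Fin K → Fin m → Bool) → ℝ := fun z =>
    if F z then 0 else 3 * n * (1 + Real.log (G z * (max b 1) ^ 2 / d)) with hV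
  have hbd : ∀ z, ¬ F z → d ≤ G z * (max b 1) ^ 2 ∧ G z * (max b 1) ^ 2 ≤ vm * Q * n ^ 4 := by
    intro z hz
    have h1 := ones_pos K m a d c B α hB hα z hz
    exact Gp_bounds b d n Q vm _ _ hn2 hd hQ hvmdef (by exact_mod_cast h1) (numOnes_le K m z)
      (var_ge K m c d hc z) (hvm z)
  have hmb : 0 < (max b 1) ^ 2 := by
    have : 1 ≤ max b 1 := le_max_right _ _
    positivity
  have hGpos : ∀ z, ¬ F z → 0 < G z := by
    intro z hz
    have := (hbd z hz).1
    by_contra hh; push Not at hh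
    nlinarith
  have hlogz : ∀ z, ¬ F z → 0 ≤ Real.log (G z * (max b 1) ^ 2 / d) := by
    intro z hz
    apply Real.log_nonneg
    rw [le_div_iff₀ hd, one_mul]; exact (hbd z hz).1
  have hV0 : ∀ z, 0 ≤ V z := by
    intro z; simp only [hV]; split_ifs with h
    · exact le_rfl
    · have := hlogz z h; positivity
  have hG0 : ∀ z, 0 ≤ G z := by
    intro z
    have hvz : 0 ≤ varWeight K m d c z := le_trans (by positivity) (var_ge K m c d hc z)
    simp only [hG, Gp]
    split_ifs
    · positivity
    · positivity
  -- main step estimate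
  have hstep : ∀ x y, ¬ F x → G y ≤ G x → V y + 3 * n * (G x - G y) / G x ≤ V x := by
    intro x y hx hyx
    have hgx := hGpos x hx
    have hlx := hlogz x hx
    by_cases hy : F y
    · simp only [hV, hy, hx, if_true, if_false]
      have h1 : (G x - G y) / G x ≤ 1 := by rw [div_le_one hgx]; linarith [hG0 y]
      rw [mul_div_assoc]
      nlinarith
    · have hgy := hGpos y hy
      simp only [hV, hy, hx, if_false]
      have h1 : Real.log (G y * (max b 1) ^ 2 / d) - Real.log (G x * (max b 1) ^ 2 / d) ≤ G y / G x - 1 := by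
        rw [← Real.log_div (by positivity) (by positivity)]
        have : G y * (max b 1) ^ 2 / d / (G x * (max b 1) ^ 2 / d) = G y / G x := by field_simp
        rw [this]
        exact Real.log_le_sub_one_of_pos (by positivity)
      have h2 : 3 * n * (G x - G y) / G x = 3 * n * (1 - G y / G x) := by field_simp
      rw [h2]
      nlinarith
  have hdec : ∀ x q, ¬ F x → fge K m a d c B α profit (setF K m x q) x := by
    intro x q hx
    by_cases hy : F (setF K m x q)
    · exact fge_feas K m a d c B α profit hα1 hp x _ hx hy
    · rw [fge_mono K m a d c B α profit hα1 x _ hx hy]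
      exact bp_le K m a d c B ha hd hc x _ (numOnes_setF_le K m x q) (var_setF_le K m c d hc hd x q)
  have hGdec : ∀ x q, ¬ F x → G (setF K m x q) ≤ G x := by
    intro x q hx
    exact bp_mono K m a d c B ha hd hc x _ Q vm hQ hvmdef hvm (ones_pos K m a d c B α hB hα x hx)
      (bp_le K m a d c B ha hd hc x _ (numOnes_setF_le K m x q) (var_setF_le K m c d hc hd x q))
  have hmain : expHitTime K m (stepP K m (mutEA K m) (fge K m a d c B α profit)) F x₀ ≤
      ENNReal.ofReal (V x₀) := by
    refine hit_bound K m _ F x₀ (fun z => ENNReal.ofReal (V z)) ?_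
    intro x hx
    have hgx := hGpos x hx
    refine drift K m hn _ V x (fun q => 3 * n * (G x - G (setF K m x q)) / G x) ?_ ?_ ?_ ?_ ?_ hV0 ?_
    · intro y hy
      by_cases hFy : F y
      · have : V y = 0 := by simp only [hV, hFy, if_true]
        rw [this]; exact hV0 x
      · rw [fge_mono K m a d c B α profit hα1 x y hx hFy] at hy
        have h1 : G y ≤ G x := bp_mono K m a d c B ha hd hc x y Q vm hQ hvmdef hvm
          (ones_pos K m a d c B α hB hα x hx) hy
        have h2 := hstep x y hx h1
        have : 0 ≤ 3 * n * (G x - G y) / G x := by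
          have : 0 ≤ G x - G y := by linarith
          positivity
        linarith
    · intro q _; exact hdec x q hx
    · intro q
      have : 0 ≤ G x - G (setF K m x q) := by linarith [hGdec x q hx]
      positivity
    · intro q hq
      simp only [setF_false K m x q hq]; simp
    · intro q _; exact hstep x _ hx (hGdec x q hx)
    · rw [← Finset.sum_div, ← Finset.mul_sum, le_div_iff₀ hgx]
      have := Gp_sum K m b d c hd hc x Q vm hQ hvmdef hvm
      gcongr
  refine hmain.trans (ENNReal.ofReal_le_ofReal ?_)
  have hlogn : 0 ≤ Real.log n := Real.log_nonneg (by linarith)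
  have hVle : V x₀ ≤ 3 * n * (1 + (8 * Real.log n + 2 * Real.log κ)) := by
    simp only [hV]
    split_ifs with h
    · positivity
    · gcongr
      have h2 : 8 * Real.log n + 2 * Real.log κ = Real.log (n ^ 8 * κ ^ 2) := by
        rw [Real.log_mul (x := n ^ 8) (by positivity) (by positivity), Real.log_pow, Real.log_pow]; push_cast; ring
      rw [h2]
      apply Real.log_le_log
      · have := hGpos x₀ h; positivity
      · rw [div_le_iff₀ hd]
        refine (hbd x₀ h).2.trans (le_of_eq ?_)
        rw [hvmdef, hQdef]; ring
  refine hVle.trans ?_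
  have h1 : 1 + (8 * Real.log n + 2 * Real.log κ) ≤ (9 + 2 * Real.log κ) * (1 + Real.log n) := by
    nlinarith [mul_nonneg hlog0 hlogn]
  have h2 : n ≤ n ^ 2 := by nlinarith
  calc _ ≤ 3 * n ^ 2 * ((9 + 2 * Real.log κ) * (1 + Real.log n)) := by gcongr
    _ = _ := by ring
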